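/- Let n ≥ 1 and let X be a metric space. Let v : X and p : ZMod n → X be points, and for each i : ZMod n write s i = dist v (p i) (the i-th spoke length) and r i = dist (p i) (p (i+1)) (the i-th rim length), so that T i denotes the triangle with vertices v, p i, p (i+1), whose side lengths are s i, s (i+1), r i. Assume general position: for every i : ZMod n, the three real numbers s i, s (i+1), r i are pairwise distinct. Say the spoke e i (from v to p i) is the longest side of T i if s i > s (i+1) and s i > r i, and is the longest side of T (i-1) if s i > s (i-1) and s i > r (i-1). Then it is impossible that every spoke is the longest side of exactly one of its two adjacent triangles; that is, the assumption 'for all i : ZMod n, exactly one of [e i is the longest side of T (i-1)] and [e i is the longest side of T i] holds' leads to a contradiction (False). -/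

import Mathlib

/-- The contradiction in the proof of Theorem 1: it is impossible that every spoke of a
cyclic fan around `v` is the strictly longest side of exactly one adjacent triangle. -/
theorem not_every_spoke_longest_of_exactly_one {n : ℕ} (hn : 1 ≤ n) {X : Type*} [MetricSpace X]
    (v : X) (p : ZMod n → X) (s r : ZMod n → ℝ)
    (hs : ∀ i, s i = dist v (p i)) (hr : ∀ i, r i = dist (p i) (p (i + 1)))
    (hgen : ∀ i : ZMod n, s i ≠ s (i + 1) ∧ s i ≠ r i ∧ s (i + 1) ≠ r i)
    (h : ∀ i : ZMod n,
      Xor' (s i > s (i - 1) ∧ s i > r (i - 1)) (s i > s (i + 1) ∧ s i > r i)) :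
    False := by
  haveI : NeZero n := ⟨by omega⟩
  obtain ⟨i, hi⟩ := Finite.exists_min s
  rcases h i with ⟨⟨h1, _⟩, _⟩ | ⟨⟨h1, _⟩, _⟩
  · exact absurd (hi (i - 1)) (not_le.mpr h1)
  · exact absurd (hi (i + 1)) (not_le.mpr h1)
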